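/- Let σ be a primitive, non-erasing, well-marked substitution over 𝔸 = {a,b} whose fixed point ξ is recurrent and not ultimately periodic, with A·B ≠ B·A and W_0, T as in the context. Then: (i) if W is a right special factor of ξ, then T(W) is a right special factor of ξ; and (ii) there exists L ∈ ℕ such that every right special factor W of ξ with |W| ≥ L is a suffix of T(U) for some right special factor U of ξ. -/

import Mathlib

namespace Subst

/-- `pow A m` is the `m`-fold concatenation `A^m`. -/
def pow (A : List Bool) : ℕ → List Bool
  | 0 => []
  | n + 1 => pow A n ++ A

/-- Membership in the submonoid of `𝔸*` generated by `{A, B}`. -/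
inductive GenAB (A B : List Bool) : List Bool → Prop
  | nil : GenAB A B []
  | appA : ∀ {W}, GenAB A B W → GenAB A B (W ++ A)
  | appB : ∀ {W}, GenAB A B W → GenAB A B (W ++ B)

/-- The extension of a substitution `σ : 𝔸 → 𝔸*` to a monoid morphism of `𝔸*`. -/
def subst (σ : Bool → List Bool) : List Bool → List Bool
  | [] => []
  | c :: w => σ c ++ subst σ w

/-- The factor `ξ[i, i+n)` of the infinite sequence `ξ`. -/
def wordAt (ξ : ℕ → Bool) (i n : ℕ) : List Bool :=
  (List.range n).map fun k => ξ (i + k)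

/-- `W` is a factor of the infinite sequence `ξ`. -/
def IsFactor (ξ : ℕ → Bool) (W : List Bool) : Prop :=
  ∃ i, W = wordAt ξ i W.length

/-- `ξ` is a fixed point of `σ`: for every `n`, `σ(ξ[0,n))` is a prefix of `ξ`. -/
def IsFixedPoint (σ : Bool → List Bool) (ξ : ℕ → Bool) : Prop :=
  ∀ n, subst σ (wordAt ξ 0 n) = wordAt ξ 0 (subst σ (wordAt ξ 0 n)).length

/-- `ξ` is recurrent: every factor occurs at infinitely many positions. -/
def Recurrent (ξ : ℕ → Bool) : Prop :=
  ∀ W, IsFactor ξ W → ∀ N, ∃ i, N ≤ i ∧ W = wordAt ξ i W.length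

/-- `ξ` is ultimately periodic. -/
def UltPeriodic (ξ : ℕ → Bool) : Prop :=
  ∃ p, 1 ≤ p ∧ ∃ N, ∀ n, N ≤ n → ξ (n + p) = ξ n

/-- `σ` is non-erasing: the image of each letter is nonempty. -/
def NonErasing (σ : Bool → List Bool) : Prop := ∀ c, σ c ≠ []

/-- `σ` is well-marked: `σ(c)` begins with the letter `c` for each letter `c`. -/
def WellMarked (σ : Bool → List Bool) : Prop := ∀ c, ∃ t, σ c = c :: t

/-- `σ` is primitive: for some `n ≥ 1`, each letter occurs in `σⁿ(d)` for each letter `d`. -/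
def Primitive (σ : Bool → List Bool) : Prop :=
  ∃ n, 1 ≤ n ∧ ∀ c d : Bool, c ∈ (subst σ)^[n] [d]

/-- `W` is a right special factor of `ξ`: both `Wa` and `Wb` are factors of `ξ`. -/
def RightSpecial (ξ : ℕ → Bool) (W : List Bool) : Prop :=
  ∀ c : Bool, IsFactor ξ (W ++ [c])

/-- `W` is a left special factor of `ξ`: both `aW` and `bW` are factors of `ξ`. -/
def LeftSpecial (ξ : ℕ → Bool) (W : List Bool) : Prop :=
  ∀ c : Bool, IsFactor ξ (c :: W)

/-- A right special factor is strong if all of `aWa, aWb, bWa, bWb` are factors. -/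
def StrongSpecial (ξ : ℕ → Bool) (W : List Bool) : Prop :=
  ∀ c d : Bool, IsFactor ξ (c :: (W ++ [d]))

/-- A right special factor is weak if neither `aW` nor `bW` is right special. -/
def WeakSpecial (ξ : ℕ → Bool) (W : List Bool) : Prop :=
  RightSpecial ξ W ∧ ∀ c : Bool, ¬ RightSpecial ξ (c :: W)

/-- The operator `T(W) = W₀ · σ(W)`. -/
def T (σ : Bool → List Bool) (W0 W : List Bool) : List Bool := W0 ++ subst σ W

/-- Specification of the word `W₀` (the longest common suffix of `A^∞` and `B^∞`)
together with the distinct letters `δ_a, δ_b`:  `δ_c · W₀` is a suffix of some power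
of `σ(c)` for each letter `c`, and `δ_a ≠ δ_b`. -/
def W0Spec (σ : Bool → List Bool) (W0 : List Bool) (δ : Bool → Bool) : Prop :=
  δ false ≠ δ true ∧ ∀ c, ∃ m, 1 ≤ m ∧ (δ c :: W0) <:+ pow (σ c) m

/-- The incidence matrix of `σ`: its columns are the Parikh vectors of `σ(a)` and `σ(b)`. -/
def incMat (σ : Bool → List Bool) : Matrix Bool Bool ℤ :=
  Matrix.of fun c d => ((σ d).count c : ℤ)

end Subst

open Subst

namespace Subst

variable {σ : Bool → List Bool} {ξ : ℕ → Bool}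

/-! ### Words, factors and the morphism -/

@[simp] theorem length_wordAt (i n : ℕ) : (wordAt ξ i n).length = n := by simp [wordAt]

theorem wordAt_succ (i n : ℕ) : wordAt ξ i (n + 1) = wordAt ξ i n ++ [ξ (i + n)] := by
  simp [wordAt, List.range_succ]

theorem wordAt_add (i m n : ℕ) : wordAt ξ i (m + n) = wordAt ξ i m ++ wordAt ξ (i + m) n := by
  induction n with
  | zero => simp [wordAt]
  | succ n ih => rw [← Nat.add_assoc, wordAt_succ, ih, wordAt_succ, List.append_assoc, Nat.add_assoc]

theorem getElem_wordAt (i n k : ℕ) (h : k < (wordAt ξ i n).length) :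
    (wordAt ξ i n)[k] = ξ (i + k) := by simp [wordAt]

theorem eq_of_eq_wordAt {i j n : ℕ} (h : wordAt ξ i n = wordAt ξ j n) {k : ℕ} (hk : k < n) :
    ξ (i + k) = ξ (j + k) := by
  rw [← getElem_wordAt (ξ := ξ) i n k (by simpa), ← getElem_wordAt (ξ := ξ) j n k (by simpa)]
  simp only [h]

theorem eq_wordAt_of_append {i n : ℕ} {s V t : List Bool} (h : s ++ V ++ t = wordAt ξ i n) :
    V = wordAt ξ (i + s.length) V.length := by
  have hn : n = s.length + V.length + t.length := by
    have := congrArg List.length h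
    simpa [Nat.add_assoc] using this.symm
  subst hn
  rw [wordAt_add, wordAt_add] at h
  have h₁ := List.append_inj_left h (by simp)
  exact List.append_inj_right h₁ (by simp)

theorem isFactor_of_isInfix {i n : ℕ} {V : List Bool} (h : V <:+: wordAt ξ i n) : IsFactor ξ V := by
  obtain ⟨s, t, h⟩ := h
  exact ⟨_, eq_wordAt_of_append h⟩

@[simp] theorem subst_append (u v : List Bool) :
    subst σ (u ++ v) = subst σ u ++ subst σ v := by
  induction u with
  | nil => rfl
  | cons c u ih => simp [subst, ih]

@[simp] theorem subst_singleton (c : Bool) : subst σ [c] = σ c := by simp [subst]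

theorem length_le_length_subst (hne : NonErasing σ) (u : List Bool) :
    u.length ≤ (subst σ u).length := by
  induction u with
  | nil => simp
  | cons c u ih =>
    have := List.length_pos_iff.2 (hne c)
    simp only [subst, List.length_append, List.length_cons]
    omega

theorem iterate_subst_append (m : ℕ) (u v : List Bool) :
    (subst σ)^[m] (u ++ v) = (subst σ)^[m] u ++ (subst σ)^[m] v := by
  induction m generalizing u v with
  | zero => rfl
  | succ m ih => simp only [Function.iterate_succ_apply, subst_append, ih]

theorem length_le_length_iterate_subst (hne : NonErasing σ) (m : ℕ) (u : List Bool) :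
    u.length ≤ ((subst σ)^[m] u).length := by
  induction m with
  | zero => rfl
  | succ m ih =>
    rw [Function.iterate_succ_apply']
    exact ih.trans (length_le_length_subst hne _)

theorem iterate_subst_wordAt (hfix : IsFixedPoint σ ξ) (m n : ℕ) :
    (subst σ)^[m] (wordAt ξ 0 n) = wordAt ξ 0 ((subst σ)^[m] (wordAt ξ 0 n)).length := by
  induction m with
  | zero => simp
  | succ m ih =>
    rw [Function.iterate_succ_apply', ih]
    exact hfix _

/-! ### Uniform recurrence -/

/-- A power of `σ` mapping each letter to a word with both letters at least doubles lengths. -/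
theorem two_mul_length_le_length_iterate_subst {n : ℕ}
    (hn : ∀ c d : Bool, c ∈ (subst σ)^[n] [d]) (u : List Bool) :
    2 * u.length ≤ ((subst σ)^[n] u).length := by
  induction u with
  | nil => simp
  | cons d u ih =>
    rw [← List.singleton_append, iterate_subst_append, List.length_append]
    have h : 2 ≤ ((subst σ)^[n] [d]).length := by
      have h₁ := hn false d
      have h₂ := hn true d
      match h : (subst σ)^[n] [d] with
      | [] => simp [h] at h₁
      | [x] => simp_all
      | x :: y :: l => simp
    simp only [List.length_append, List.length_cons, List.length_nil]
    omega

theorem exists_le_length_iterate_subst (hprim : Primitive σ) (d : Bool) (q : ℕ) :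
    ∃ m, q ≤ ((subst σ)^[m] [d]).length := by
  obtain ⟨n, -, hn⟩ := hprim
  induction q with
  | zero => exact ⟨0, by simp⟩
  | succ q ih =>
    obtain ⟨m, hm⟩ := ih
    rcases Nat.eq_zero_or_pos q with rfl | hq
    · exact ⟨0, by simp⟩
    · refine ⟨n + m, ?_⟩
      rw [Function.iterate_add_apply]
      have := two_mul_length_le_length_iterate_subst hn ((subst σ)^[m] [d])
      omega

/-- Each factor of `ξ` occurs in the image of every letter under some power of `σ`. -/
theorem exists_infix_iterate_subst (hprim : Primitive σ) (hfix : IsFixedPoint σ ξ)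
    {V : List Bool} (hV : IsFactor ξ V) : ∃ K, ∀ d, V <:+: (subst σ)^[K] [d] := by
  obtain ⟨i, hi⟩ := hV
  obtain ⟨m, hm⟩ := exists_le_length_iterate_subst hprim (ξ 0) (i + V.length)
  have hpre : V <:+: (subst σ)^[m] [ξ 0] := by
    have h := iterate_subst_wordAt hfix m 1
    rw [show wordAt ξ 0 1 = [ξ 0] from rfl] at h
    rw [h]
    obtain ⟨r, hr⟩ := Nat.exists_eq_add_of_le hm
    rw [hr, wordAt_add, wordAt_add, Nat.zero_add, ← hi]
    exact ⟨_, _, rfl⟩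
  obtain ⟨n, -, hn⟩ := hprim
  refine ⟨m + n, fun d => ?_⟩
  obtain ⟨s, t, hst⟩ := List.append_of_mem (hn (ξ 0) d)
  rw [Function.iterate_add_apply, hst, ← List.singleton_append, iterate_subst_append,
    iterate_subst_append]
  exact hpre.trans ⟨_, _, by rw [List.append_assoc]⟩

theorem uniformlyRecurrent (hne : NonErasing σ) (hprim : Primitive σ) (hfix : IsFixedPoint σ ξ)
    {V : List Bool} (hV : IsFactor ξ V) :
    ∃ R, ∀ i, ∃ k < R, V = wordAt ξ (i + k) V.length := by
  obtain ⟨K, hK⟩ := exists_infix_iterate_subst hprim hfix hV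
  set h : ℕ → ℕ := fun n => ((subst σ)^[K] (wordAt ξ 0 n)).length with hh
  set D := ((subst σ)^[K] [false]).length + ((subst σ)^[K] [true]).length with hD
  have hlen : ∀ d, ((subst σ)^[K] [d]).length ≤ D := by
    intro d
    cases d <;> omega
  have hsucc : ∀ n, h (n + 1) = h n + ((subst σ)^[K] [ξ n]).length := by
    intro n
    simp only [hh, wordAt_succ, iterate_subst_append, List.length_append, Nat.zero_add]
  refine ⟨2 * D + 1, fun i => ?_⟩
  have hex : ∃ n, i ≤ h n :=
    ⟨i, by simpa [hh] using length_le_length_iterate_subst hne K (wordAt ξ 0 i)⟩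
  obtain ⟨n, hin, hni⟩ : ∃ n, i ≤ h n ∧ h n ≤ i + D := by
    refine ⟨Nat.find hex, Nat.find_spec hex, ?_⟩
    rcases hf : Nat.find hex with _ | n
    · simp [hh, wordAt, Function.iterate_fixed (show subst σ [] = [] from rfl)]
    · have h₁ : ¬ i ≤ h n := Nat.find_min hex (by omega)
      have := hlen (ξ n)
      rw [hsucc]
      omega
  obtain ⟨s, t, hst⟩ := hK (ξ n)
  have hs : s.length ≤ D := by
    have h₁ := congrArg List.length hst
    have h₂ := hlen (ξ n)
    simp only [List.length_append] at h₁
    omega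
  refine ⟨h n - i + s.length, by omega, ?_⟩
  have hpre := iterate_subst_wordAt hfix K (n + 1)
  rw [wordAt_succ, iterate_subst_append, Nat.zero_add, ← hst] at hpre
  have := eq_wordAt_of_append (s := (subst σ)^[K] (wordAt ξ 0 n) ++ s) (V := V) (t := t)
    (by rw [← hpre]; simp only [List.append_assoc])
  rw [List.length_append, Nat.zero_add] at this
  rw [show i + (h n - i + s.length) = h n + s.length by omega]
  exact this

theorem exists_ne_in_window (hne : NonErasing σ) (hprim : Primitive σ) (hfix : IsFixedPoint σ ξ)
    (hnp : ¬ UltPeriodic ξ) {p : ℕ} (hp : 1 ≤ p) :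
    ∃ N, ∀ i, ∃ k < N, ξ (i + k + p) ≠ ξ (i + k) := by
  obtain ⟨n, hn⟩ : ∃ n, ξ (n + p) ≠ ξ n := by
    by_contra! h
    exact hnp ⟨p, hp, 0, fun n _ => h n⟩
  obtain ⟨R, hR⟩ := uniformlyRecurrent hne hprim hfix
    (V := wordAt ξ n (p + 1)) ⟨n, by simp⟩
  refine ⟨R, fun i => ?_⟩
  obtain ⟨k, hk, h⟩ := hR i
  rw [length_wordAt] at h
  refine ⟨k, hk, ?_⟩
  have h₁ := eq_of_eq_wordAt h (Nat.lt_succ_self p)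
  have h₂ := eq_of_eq_wordAt h (Nat.succ_pos p)
  rw [Nat.add_zero, Nat.add_zero] at h₂
  rwa [← h₁, ← h₂]

theorem exists_ne_in_window_of_le (hne : NonErasing σ) (hprim : Primitive σ)
    (hfix : IsFixedPoint σ ξ) (hnp : ¬ UltPeriodic ξ) (M : ℕ) :
    ∃ N, ∀ p, 1 ≤ p → p ≤ M → ∀ i, ∃ k < N, ξ (i + k + p) ≠ ξ (i + k) := by
  induction M with
  | zero => exact ⟨0, fun p h₁ h₂ => by omega⟩
  | succ M ih =>
    obtain ⟨N, hN⟩ := ih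
    obtain ⟨N', hN'⟩ := exists_ne_in_window hne hprim hfix hnp (Nat.succ_pos M)
    refine ⟨max N N', fun p h₁ h₂ i => ?_⟩
    rcases Nat.lt_or_ge M p with h | h
    · obtain rfl : p = M + 1 := by omega
      obtain ⟨k, hk, hne⟩ := hN' i
      exact ⟨k, lt_max_of_lt_right hk, hne⟩
    · obtain ⟨k, hk, hne⟩ := hN p h₁ h i
      exact ⟨k, lt_max_of_lt_left hk, hne⟩

/-! ### The parse of the fixed point into images of letters -/

/-- From the pair (letter `c`, offset in `σ c`) describing a position, the pair describing the
next position, whose letter is `x`. -/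
def advance (σ : Bool → List Bool) (s : Bool × ℕ) (x : Bool) : Bool × ℕ :=
  if s.2 + 1 < (σ s.1).length then (s.1, s.2 + 1) else (x, 0)

/-- The block letter and the offset of the position `p` in the parse of `ξ` into blocks. -/
def parse (σ : Bool → List Bool) (ξ : ℕ → Bool) : ℕ → Bool × ℕ
  | 0 => (ξ 0, 0)
  | p + 1 => advance σ (parse σ ξ p) (ξ (p + 1))

/-- The letter at an offset of a block. -/
def blockLetter (σ : Bool → List Bool) (s : Bool × ℕ) : Bool := (σ s.1).getD s.2 false

theorem apply_cut_add (hfix : IsFixedPoint σ ξ) (n r : ℕ) (hr : r < (σ (ξ n)).length) :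
    ξ ((subst σ (wordAt ξ 0 n)).length + r) = blockLetter σ (ξ n, r) := by
  have h := hfix (n + 1)
  rw [wordAt_succ, Nat.zero_add, subst_append, subst_singleton] at h
  have := eq_wordAt_of_append (t := []) (by rw [List.append_nil]; exact h)
  rw [Nat.zero_add] at this
  simp only [blockLetter, List.getD_eq_getElem _ _ hr]
  rw [← getElem_wordAt (ξ := ξ) _ (σ (ξ n)).length r (by simpa)]
  simp only [← this]

theorem apply_cut (hfix : IsFixedPoint σ ξ) (hwm : WellMarked σ) (n : ℕ) :
    ξ (subst σ (wordAt ξ 0 n)).length = ξ n := by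
  obtain ⟨t, ht⟩ := hwm (ξ n)
  have := apply_cut_add hfix n 0 (by simp [ht])
  simpa [blockLetter, ht] using this

theorem parse_spec (hfix : IsFixedPoint σ ξ) (hwm : WellMarked σ) (p : ℕ) :
    ∃ n r, p = (subst σ (wordAt ξ 0 n)).length + r ∧ parse σ ξ p = (ξ n, r) ∧
      r < (σ (ξ n)).length := by
  have hpos : ∀ c, 0 < (σ c).length := fun c => by
    obtain ⟨t, ht⟩ := hwm c
    simp [ht]
  induction p with
  | zero => exact ⟨0, 0, rfl, rfl, hpos _⟩
  | succ p ih =>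
    obtain ⟨n, r, hp, hpar, hr⟩ := ih
    simp only [parse, hpar, advance]
    split_ifs with h
    · exact ⟨n, r + 1, by omega, rfl, h⟩
    · have hcut : p + 1 = (subst σ (wordAt ξ 0 (n + 1))).length := by
        rw [wordAt_succ, subst_append, List.length_append, subst_singleton, Nat.zero_add]
        omega
      refine ⟨n + 1, 0, hcut, ?_, hpos _⟩
      rw [hcut, apply_cut hfix hwm]

theorem apply_eq_blockLetter_parse (hfix : IsFixedPoint σ ξ) (hwm : WellMarked σ) (p : ℕ) :
    ξ p = blockLetter σ (parse σ ξ p) := by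
  obtain ⟨n, r, hp, hpar, hr⟩ := parse_spec hfix hwm p
  rw [hpar, ← apply_cut_add hfix n r hr, ← hp]

theorem parse_eq_of_snd_eq_zero (hfix : IsFixedPoint σ ξ) (hwm : WellMarked σ) {p : ℕ}
    (h : (parse σ ξ p).2 = 0) :
    parse σ ξ p = (ξ p, 0) ∧ ∃ n, p = (subst σ (wordAt ξ 0 n)).length ∧ ξ n = ξ p := by
  obtain ⟨n, r, hp, hpar, hr⟩ := parse_spec hfix hwm p
  obtain rfl : r = 0 := by simpa [hpar] using h
  rw [Nat.add_zero] at hp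
  have hn : ξ n = ξ p := by rw [hp, apply_cut hfix hwm]
  exact ⟨by rw [hpar, hn], n, hp, hn⟩

/-- The successor of a pair of parse states at positions carrying the same letters, when not both
positions are cuts. -/
def advancePair (σ : Bool → List Bool) (s : (Bool × ℕ) × (Bool × ℕ)) :
    (Bool × ℕ) × (Bool × ℕ) :=
  if s.1.2 + 1 < (σ s.1.1).length then
    ((s.1.1, s.1.2 + 1), advance σ s.2 (blockLetter σ (s.1.1, s.1.2 + 1)))
  else (advance σ s.1 (blockLetter σ (s.2.1, s.2.2 + 1)), (s.2.1, s.2.2 + 1))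

theorem parse_pair_succ (hfix : IsFixedPoint σ ξ) (hwm : WellMarked σ) {p q : ℕ}
    (hpq : ξ (p + 1) = ξ (q + 1))
    (hcut : ¬ ((parse σ ξ (p + 1)).2 = 0 ∧ (parse σ ξ (q + 1)).2 = 0)) :
    (parse σ ξ (p + 1), parse σ ξ (q + 1)) = advancePair σ (parse σ ξ p, parse σ ξ q) := by
  have hp := apply_eq_blockLetter_parse hfix hwm (p + 1)
  have hq := apply_eq_blockLetter_parse hfix hwm (q + 1)
  simp only [parse, advance, advancePair] at hp hq hcut ⊢
  by_cases h₁ : (parse σ ξ p).2 + 1 < (σ (parse σ ξ p).1).length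
  · simp only [h₁, if_true] at hp ⊢
    rw [← hp, hpq]
  · by_cases h₂ : (parse σ ξ q).2 + 1 < (σ (parse σ ξ q).1).length
    · simp only [h₁, h₂, if_true, if_false] at hq ⊢
      rw [← hq, hpq]
    · simp [h₁, h₂] at hcut

/-- Two occurrences of a long enough word have a common cut. -/
theorem exists_common_cut (hne : NonErasing σ) (hwm : WellMarked σ) (hprim : Primitive σ)
    (hfix : IsFixedPoint σ ξ) (hnp : ¬ UltPeriodic ξ) :
    ∃ L, ∀ i j, (∀ k < L, ξ (i + k) = ξ (j + k)) →
      ∃ k < L, (parse σ ξ (i + k)).2 = 0 ∧ (parse σ ξ (j + k)).2 = 0 := by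
  set D := (σ false).length + (σ true).length with hD
  set S : Finset (Bool × ℕ) := Finset.univ ×ˢ Finset.range D with hS
  set M := (S ×ˢ S).card with hM
  have hmem : ∀ p, parse σ ξ p ∈ S := by
    intro p
    obtain ⟨n, r, -, hpar, hr⟩ := parse_spec hfix hwm p
    have : (σ (ξ n)).length ≤ D := by cases ξ n <;> omega
    simp only [hS, hpar, Finset.mem_product, Finset.mem_univ, Finset.mem_range, true_and]
    omega
  obtain ⟨N, hN⟩ := exists_ne_in_window_of_le hne hprim hfix hnp M
  refine ⟨M + N + 1, fun i j hij => ?_⟩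
  by_contra! hcut
  set t : ℕ → (Bool × ℕ) × (Bool × ℕ) := fun k => (parse σ ξ (i + k), parse σ ξ (j + k)) with ht
  have hstep : ∀ k, k + 1 < M + N + 1 → t (k + 1) = advancePair σ (t k) := fun k hk =>
    parse_pair_succ hfix hwm (hij (k + 1) hk) (fun h => hcut (k + 1) hk h.1 h.2)
  obtain ⟨x, hx, y, hy, hxy, htxy⟩ := Finset.exists_ne_map_eq_of_card_lt_of_maps_to
    (s := Finset.range (M + 1)) (t := S ×ˢ S) (f := t) (by simp [← hM])
    (fun k _ => Finset.mem_product.2 ⟨hmem _, hmem _⟩)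
  wlog hlt : x < y generalizing x y
  · exact this y hy x hx hxy.symm htxy.symm (by omega)
  simp only [Finset.mem_range] at hx hy
  have hper : ∀ m, y + m < M + N + 1 → t (x + m) = t (y + m) := by
    intro m
    induction m with
    | zero => exact fun _ => htxy
    | succ m ih =>
      intro hm
      rw [← Nat.add_assoc, ← Nat.add_assoc, hstep _ (by omega), hstep _ (by omega), ih (by omega)]
  obtain ⟨k, hk, hne⟩ := hN (y - x) (by omega) (by omega) (i + x)
  apply hne
  have h := congrArg Prod.fst (hper k (by omega))
  simp only [ht] at h
  rw [show i + x + k + (y - x) = i + (y + k) by omega, Nat.add_assoc,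
    apply_eq_blockLetter_parse hfix hwm (i + (y + k)),
    apply_eq_blockLetter_parse hfix hwm (i + (x + k)), h]

/-- If two occurrences of a word share a cut and are followed by different letters, then both
occurrences end at a cut. -/
theorem cut_of_common_cut (hfix : IsFixedPoint σ ξ) (hwm : WellMarked σ) {i j k n : ℕ}
    (hij : ∀ l < n, ξ (i + l) = ξ (j + l)) (hne : ξ (i + n) ≠ ξ (j + n)) (hk : k < n)
    (hi : (parse σ ξ (i + k)).2 = 0) (hj : (parse σ ξ (j + k)).2 = 0) :
    (parse σ ξ (i + n)).2 = 0 ∧ (parse σ ξ (j + n)).2 = 0 := by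
  have hpar : ∀ m, k + m < n → parse σ ξ (i + (k + m)) = parse σ ξ (j + (k + m)) := by
    intro m
    induction m with
    | zero =>
      intro _
      rw [Nat.add_zero, (parse_eq_of_snd_eq_zero hfix hwm hi).1,
        (parse_eq_of_snd_eq_zero hfix hwm hj).1, hij k hk]
    | succ m ih =>
      intro hm
      have h := hij _ hm
      simp only [← Nat.add_assoc] at h ih ⊢
      simp only [parse]
      rw [ih (by omega), h]
  obtain ⟨m, rfl⟩ : ∃ m, n = k + m + 1 := ⟨n - k - 1, by omega⟩
  have h := hpar m (by omega)
  have hi' : parse σ ξ (i + (k + m + 1)) = advance σ (parse σ ξ (j + (k + m)))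
      (ξ (i + (k + m + 1))) := by rw [← h]; rfl
  have hj' : parse σ ξ (j + (k + m + 1)) = advance σ (parse σ ξ (j + (k + m)))
      (ξ (j + (k + m + 1))) := rfl
  by_cases hlt : (parse σ ξ (j + (k + m))).2 + 1 < (σ (parse σ ξ (j + (k + m))).1).length
  · refine absurd ?_ hne
    rw [apply_eq_blockLetter_parse hfix hwm (i + (k + m + 1)),
      apply_eq_blockLetter_parse hfix hwm (j + (k + m + 1)), hi', hj']
    simp only [advance, hlt, if_true]
  · rw [hi', hj']
    simp only [advance, hlt, if_false, and_self]

/-! ### Common suffixes of images -/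

theorem pow_succ_eq (A : List Bool) (n : ℕ) : pow A (n + 1) = A ++ pow A n := by
  induction n with
  | zero => simp [pow]
  | succ n ih => rw [pow, ih, List.append_assoc, ← ih, pow]

theorem cons_suffix_append (hne : NonErasing σ) {W0 : List Bool} {δ : Bool → Bool}
    (hW0 : W0Spec σ W0 δ) (c : Bool) : (δ c :: W0) <:+ W0 ++ σ c := by
  obtain ⟨-, h⟩ := hW0
  obtain ⟨m, -, hm⟩ := h c
  have h₁ : (δ c :: W0) <:+ pow (σ c) (m + 1) :=
    hm.trans (by rw [pow_succ_eq]; exact List.suffix_append _ _)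
  have h₂ : W0 ++ σ c <:+ pow (σ c) (m + 1) := by
    obtain ⟨s, hs⟩ := (List.suffix_cons _ _).trans hm
    exact ⟨s, by rw [← List.append_assoc, hs]; rfl⟩
  refine List.suffix_of_suffix_length_le h₁ h₂ ?_
  have := List.length_pos_iff.2 (hne c)
  simp only [List.length_cons, List.length_append]
  omega

theorem suffix_append_subst (hne : NonErasing σ) {W0 : List Bool} {δ : Bool → Bool}
    (hW0 : W0Spec σ W0 δ) (X : List Bool) : W0 <:+ W0 ++ subst σ X := by
  induction X using List.reverseRecOn with
  | nil => simp [subst]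
  | append_singleton X c ih =>
    rw [subst_append, subst_singleton, ← List.append_assoc]
    obtain ⟨s, hs⟩ := ih
    rw [← hs, List.append_assoc]
    exact ((List.suffix_cons _ _).trans (cons_suffix_append hne hW0 c)).trans
      (List.suffix_append _ _)

theorem cons_suffix_append_subst (hne : NonErasing σ) {W0 : List Bool} {δ : Bool → Bool}
    (hW0 : W0Spec σ W0 δ) (X : List Bool) (c : Bool) :
    (δ c :: W0) <:+ W0 ++ subst σ (X ++ [c]) := by
  obtain ⟨s, hs⟩ := suffix_append_subst hne hW0 X
  rw [subst_append, subst_singleton, ← List.append_assoc, ← hs, List.append_assoc]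
  exact (cons_suffix_append hne hW0 c).trans (List.suffix_append _ _)

theorem exists_longest_common_suffix (X Y : List Bool) :
    ∃ Z₁ Z₂ U, X = Z₁ ++ U ∧ Y = Z₂ ++ U ∧
      (Z₁ = [] ∨ Z₂ = [] ∨ ∃ Z₁' Z₂' c d, Z₁ = Z₁' ++ [c] ∧ Z₂ = Z₂' ++ [d] ∧ c ≠ d) := by
  induction X using List.reverseRecOn generalizing Y with
  | nil => exact ⟨[], Y, [], by simp⟩
  | append_singleton X c ih =>
    rcases List.eq_nil_or_concat Y with rfl | ⟨Y, d, rfl⟩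
    · exact ⟨X ++ [c], [], [], by simp⟩
    · by_cases hcd : c = d
      · subst hcd
        obtain ⟨Z₁, Z₂, U, rfl, rfl, h⟩ := ih Y
        exact ⟨Z₁, Z₂, U ++ [c], by simp, by simp, h⟩
      · exact ⟨X ++ [c], Y ++ [d], [], by simp, by simp,
          Or.inr (Or.inr ⟨X, Y, c, d, rfl, rfl, hcd⟩)⟩

/-- A common suffix of `σ(X)` and `σ(Y)` is a suffix of `T(U)` for a common suffix `U` of `X`
and `Y`. -/
theorem exists_suffix_T (hne : NonErasing σ) {W0 : List Bool} {δ : Bool → Bool}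
    (hW0 : W0Spec σ W0 δ) {X Y W : List Bool} (hX : W <:+ subst σ X) (hY : W <:+ subst σ Y) :
    ∃ U, U <:+ X ∧ U <:+ Y ∧ W <:+ T σ W0 U := by
  obtain ⟨Z₁, Z₂, U, rfl, rfl, h⟩ := exists_longest_common_suffix X Y
  refine ⟨U, List.suffix_append _ _, List.suffix_append _ _, ?_⟩
  rcases h with rfl | rfl | ⟨Z₁, Z₂, c, d, rfl, rfl, hcd⟩
  · exact hX.trans (List.suffix_append _ _)
  · exact hY.trans (List.suffix_append _ _)
  · have key : ∀ Z e, W <:+ subst σ (Z ++ [e] ++ U) →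
        W <:+ W0 ++ subst σ (Z ++ [e]) ++ subst σ U ∧
        (δ e :: T σ W0 U) <:+ W0 ++ subst σ (Z ++ [e]) ++ subst σ U := by
      intro Z e hW
      refine ⟨?_, ?_⟩
      · rw [List.append_assoc, ← subst_append]
        exact hW.trans (List.suffix_append _ _)
      · obtain ⟨s, hs⟩ := cons_suffix_append_subst hne hW0 Z e
        exact ⟨s, by rw [← hs]; simp [T]⟩
    obtain ⟨hX₁, hX₂⟩ := key _ _ hX
    obtain ⟨hY₁, hY₂⟩ := key _ _ hY
    rcases Nat.lt_or_ge (T σ W0 U).length W.length with hlt | hle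
    · exfalso
      have h₁ := List.suffix_of_suffix_length_le hX₂ hX₁ (by simpa using hlt)
      have h₂ := List.suffix_of_suffix_length_le hY₂ hY₁ (by simpa using hlt)
      have h₃ := (List.suffix_of_suffix_length_le h₁ h₂ (by simp)).eq_of_length (by simp)
      have h₄ : δ c = δ d := (List.cons.inj h₃).1
      have h₅ := hW0.1
      cases c <;> cases d <;> simp_all
    · exact List.suffix_of_suffix_length_le hX₁ ((List.suffix_cons _ _).trans hX₂) hle

/-! ### Right special factors -/

theorem rightSpecial_T (hne : NonErasing σ) (hwm : WellMarked σ) {W0 : List Bool}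
    {δ : Bool → Bool} (hW0 : W0Spec σ W0 δ) (hfix : IsFixedPoint σ ξ) (hrec : Recurrent ξ)
    {W : List Bool} (hW : RightSpecial ξ W) : RightSpecial ξ (T σ W0 W) := by
  intro c
  obtain ⟨i, hi, h⟩ := hrec _ (hW c) W0.length
  have hsuf : W0 <:+ subst σ (wordAt ξ 0 i) := by
    refine List.suffix_of_suffix_length_le (suffix_append_subst hne hW0 _)
      (List.suffix_append _ _) (hi.trans ?_)
    simpa using length_le_length_subst hne (wordAt ξ 0 i)
  have hpre := hfix (i + (W ++ [c]).length)
  rw [wordAt_add, Nat.zero_add, ← h] at hpre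
  apply isFactor_of_isInfix
  rw [← hpre]
  obtain ⟨s, hs⟩ := hsuf
  obtain ⟨t, ht⟩ := hwm c
  exact ⟨s, t, by simp [T, ← hs, ht]⟩

theorem exists_rightSpecial_suffix_T (hne : NonErasing σ) (hwm : WellMarked σ)
    (hprim : Primitive σ) {W0 : List Bool} {δ : Bool → Bool} (hW0 : W0Spec σ W0 δ)
    (hfix : IsFixedPoint σ ξ) (hnp : ¬ UltPeriodic ξ) :
    ∃ L, ∀ W, RightSpecial ξ W → L ≤ W.length →
      ∃ U, IsFactor ξ U ∧ RightSpecial ξ U ∧ W <:+ T σ W0 U := by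
  obtain ⟨L, hL⟩ := exists_common_cut hne hwm hprim hfix hnp
  refine ⟨L, fun W hW hlen => ?_⟩
  have hocc : ∀ c, ∃ i, W = wordAt ξ i W.length ∧ ξ (i + W.length) = c := by
    intro c
    obtain ⟨i, hi⟩ := hW c
    rw [List.length_append, List.length_singleton, wordAt_succ] at hi
    have h := List.append_inj hi (by simp)
    exact ⟨i, h.1, by simpa using h.2.symm⟩
  obtain ⟨i, hi, hic⟩ := hocc false
  obtain ⟨j, hj, hjc⟩ := hocc true
  have hij : ∀ k < W.length, ξ (i + k) = ξ (j + k) := fun k hk =>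
    eq_of_eq_wordAt (hi.symm.trans hj) hk
  obtain ⟨k, hk, hk₁, hk₂⟩ := hL i j fun k hk => hij k (hk.trans_le hlen)
  obtain ⟨h₁, h₂⟩ := cut_of_common_cut hfix hwm hij (by simp [hic, hjc]) (hk.trans_le hlen) hk₁ hk₂
  have hsuf : ∀ i c, W = wordAt ξ i W.length → ξ (i + W.length) = c →
      (parse σ ξ (i + W.length)).2 = 0 →
      ∃ n, ξ n = c ∧ W <:+ subst σ (wordAt ξ 0 n) := by
    intro i c hi hic h
    obtain ⟨-, n, hn, hnc⟩ := parse_eq_of_snd_eq_zero hfix hwm h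
    refine ⟨n, hnc.trans hic, ?_⟩
    rw [hfix n, ← hn, wordAt_add, Nat.zero_add, ← hi]
    exact List.suffix_append _ _
  obtain ⟨m, hm, hWm⟩ := hsuf i false hi hic h₁
  obtain ⟨n, hn, hWn⟩ := hsuf j true hj hjc h₂
  obtain ⟨U, hUm, hUn, hWU⟩ := exists_suffix_T hne hW0 hWm hWn
  have hext : ∀ n, U <:+ wordAt ξ 0 n → IsFactor ξ (U ++ [ξ n]) := by
    rintro n ⟨s, hs⟩
    refine isFactor_of_isInfix (i := 0) (n := n + 1) ⟨s, [], ?_⟩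
    rw [wordAt_succ, ← hs, Nat.zero_add]
    simp
  refine ⟨U, isFactor_of_isInfix hUm.isInfix, ?_, hWU⟩
  rintro (_ | _)
  · exact hm ▸ hext m hUm
  · exact hn ▸ hext n hUn

end Subst

/-- (i) `T` maps right special factors of `ξ` to right special factors;
(ii) there exists `L` such that every right special factor `W` with `|W| ≥ L` is a
suffix of `T(U)` for some right special factor `U`. -/
theorem statement14 (σ : Bool → List Bool) (hne : NonErasing σ)
    (hwm : WellMarked σ) (hprim : Primitive σ)
    (hAB : σ false ++ σ true ≠ σ true ++ σ false)
    (W0 : List Bool) (δ : Bool → Bool) (hW0 : W0Spec σ W0 δ)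
    (ξ : ℕ → Bool) (hfix : IsFixedPoint σ ξ) (hrec : Recurrent ξ)
    (hnp : ¬ UltPeriodic ξ) :
    (∀ W : List Bool, IsFactor ξ W → RightSpecial ξ W → RightSpecial ξ (T σ W0 W)) ∧
    (∃ L : ℕ, ∀ W : List Bool, IsFactor ξ W → RightSpecial ξ W → L ≤ W.length →
        ∃ U : List Bool, IsFactor ξ U ∧ RightSpecial ξ U ∧ W <:+ T σ W0 U) :=
  ⟨fun _ _ hW => rightSpecial_T hne hwm hW0 hfix hrec hW,
    (exists_rightSpecial_suffix_T hne hwm hprim hW0 hfix hnp).imp fun _ h W _ => h W⟩
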